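/- arXiv:math/0007072 — 3 statements merged into one kernel-verified Lean document; each statement's English description precedes it below -/
import Mathlib

section
/- For integers r ≥ 1 and n ≥ 2, the ℂ-algebra homomorphism from ℂ[x, y_1, …, y_n] to the invariant ring ℂ[Z_1,…,Z_n]^{A_r(n)} sending x ↦ Z_1⋯Z_n and y_j ↦ Z_j^{r+1} is surjective and its kernel is the principal ideal generated by x^{r+1} − y_1⋯y_n; hence the invariant ring is isomorphic to ℂ[x, y_1, …, y_n]/(x^{r+1} − y_1⋯y_n), the coordinate ring of the hypersurface S_{A_r(n)} = { (x, y_1,…,y_n) ∈ ℂ^{n+1} : x^{r+1} = y_1⋯y_n }. -/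
open MvPolynomial

/-- The algebra map `x ↦ ∏ i, Z_i`, `y_j ↦ Z_j ^ N`. -/
noncomputable def prodPowHom (R : Type*) [CommRing R] (N n : ℕ) :
    MvPolynomial (Fin (n + 1)) R →ₐ[R] MvPolynomial (Fin n) R :=
  aeval (Fin.cons (∏ i, X i) fun j => (X j : MvPolynomial (Fin n) R) ^ N)

/-- The linear map sending the monomial `Z ^ m` to `x ^ (m k % N) * ∏ j, y_j ^ (m j / N)`. -/
noncomputable def divModLinearMap (R : Type*) [CommRing R] (N : ℕ) {n : ℕ} (k : Fin n) :
    MvPolynomial (Fin n) R →ₗ[R] MvPolynomial (Fin (n + 1)) R :=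
  (basisMonomials (Fin n) R).constr R fun m => X 0 ^ (m k % N) * ∏ j : Fin n, X j.succ ^ (m j / N)

section

variable {R : Type*} [CommRing R] {N n : ℕ}

@[simp]
theorem prodPowHom_X_zero : prodPowHom R N n (X 0) = ∏ i, X i := by
  simp [prodPowHom]

@[simp]
theorem prodPowHom_X_succ (j : Fin n) : prodPowHom R N n (X j.succ) = X j ^ N := by
  simp [prodPowHom]

theorem divModLinearMap_monomial (k : Fin n) (m : Fin n →₀ ℕ) (a : R) :
    divModLinearMap R N k (monomial m a) =
      a • (X 0 ^ (m k % N) * ∏ j : Fin n, X j.succ ^ (m j / N)) := by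
  have h : monomial m a = a • basisMonomials (Fin n) R m := by
    simp [smul_monomial]
  rw [h, map_smul, divModLinearMap, Module.Basis.constr_basis]

theorem monomial_eq_smul_prod_X_pow {σ : Type*} [Fintype σ] (m : σ →₀ ℕ) (a : R) :
    monomial m a = a • ∏ i, (X i : MvPolynomial σ R) ^ m i := by
  rw [monomial_eq, smul_eq_C_mul, Finsupp.prod_fintype _ _ (by simp)]

theorem prodPowHom_divModLinearMap_monomial (k : Fin n) (m : Fin n →₀ ℕ) (a : R)
    (hm : ∀ j, m j % N = m k % N) :
    prodPowHom R N n (divModLinearMap R N k (monomial m a)) = monomial m a := by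
  rw [divModLinearMap_monomial, monomial_eq_smul_prod_X_pow, map_smul]
  simp only [map_mul, map_pow, map_prod, prodPowHom_X_zero, prodPowHom_X_succ]
  rw [← Finset.prod_pow, ← Finset.prod_mul_distrib]
  refine congrArg (a • ·) (Finset.prod_congr rfl fun j _ => ?_)
  rw [← pow_mul, ← pow_add, ← hm j, Nat.mod_add_div]

theorem prodPowHom_monomial (e : Fin (n + 1) →₀ ℕ) (a : R) :
    prodPowHom R N n (monomial e a) =
      monomial (Finsupp.equivFunOnFinite.symm fun j => e 0 + N * e j.succ) a := by
  rw [monomial_eq_smul_prod_X_pow, monomial_eq_smul_prod_X_pow, map_smul, Fin.prod_univ_succ]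
  simp [Finset.prod_pow, Finset.prod_mul_distrib, pow_add, pow_mul]

theorem divModLinearMap_prodPowHom_sub_mem (hN : 0 < N) (k : Fin n)
    (p : MvPolynomial (Fin (n + 1)) R) :
    divModLinearMap R N k (prodPowHom R N n p) - p ∈
      Ideal.span {(X 0 : MvPolynomial (Fin (n + 1)) R) ^ N - ∏ j : Fin n, X j.succ} := by
  induction p using MvPolynomial.induction_on' with
  | add p q hp hq =>
    rw [map_add, map_add, add_sub_add_comm]
    exact add_mem hp hq
  | monomial e a =>
    rw [prodPowHom_monomial, divModLinearMap_monomial, monomial_eq_smul_prod_X_pow,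
      Fin.prod_univ_succ, ← Ideal.Quotient.eq, smul_eq_C_mul, smul_eq_C_mul]
    have h := (Ideal.Quotient.eq (I := Ideal.span
      {(X 0 : MvPolynomial (Fin (n + 1)) R) ^ N - ∏ j : Fin n, X j.succ})).2
      (Ideal.mem_span_singleton_self _)
    simp only [Finsupp.coe_equivFunOnFinite_symm, Nat.add_mul_mod_self_left,
      Nat.add_mul_div_left _ _ hN, pow_add, Finset.prod_mul_distrib, Finset.prod_pow]
    rw [← mul_assoc (X 0 ^ (e 0 % N))]
    simp only [map_mul, map_pow _ (∏ j : Fin n, _)] at h ⊢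
    rw [← h, ← map_pow, ← map_mul, ← pow_mul, ← pow_add, Nat.mod_add_div]

theorem ker_prodPowHom (hN : 0 < N) (k : Fin n) :
    RingHom.ker (prodPowHom R N n) =
      Ideal.span {(X 0 : MvPolynomial (Fin (n + 1)) R) ^ N - ∏ j : Fin n, X j.succ} := by
  refine le_antisymm (fun p hp => ?_) ?_
  · have h := divModLinearMap_prodPowHom_sub_mem hN k p
    rwa [RingHom.mem_ker.1 hp, map_zero, zero_sub, neg_mem_iff] at h
  · rw [Ideal.span_singleton_le_iff_mem, RingHom.mem_ker]
    simp [Finset.prod_pow]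

theorem aeval_C_mul_X_monomial {σ : Type*} [Fintype σ] (d : σ → R) (m : σ →₀ ℕ) (a : R) :
    aeval (fun i => C (d i) * X i) (monomial m a) = monomial m ((∏ i, d i ^ m i) * a) := by
  rw [monomial_eq_smul_prod_X_pow, monomial_eq_smul_prod_X_pow, map_smul]
  simp only [map_prod, map_pow, aeval_X, mul_pow, Finset.prod_mul_distrib, smul_eq_C_mul,
    map_mul]
  ring

theorem coeff_aeval_C_mul_X {σ : Type*} [Fintype σ] (d : σ → R) (m : σ →₀ ℕ)
    (p : MvPolynomial σ R) :
    coeff m (aeval (fun i => C (d i) * X i) p) = (∏ i, d i ^ m i) * coeff m p := by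
  classical
  induction p using MvPolynomial.induction_on' with
  | add p q hp hq => simp only [map_add, coeff_add, hp, hq, mul_add]
  | monomial e a =>
    rw [aeval_C_mul_X_monomial, coeff_monomial, coeff_monomial]
    split_ifs with h
    · rw [h]
    · simp

theorem aeval_C_mul_X_prodPowHom (d : Fin n → R) (hd : ∀ i, d i ^ N = 1) (hd' : ∏ i, d i = 1)
    (p : MvPolynomial (Fin (n + 1)) R) :
    aeval (fun i => C (d i) * X i) (prodPowHom R N n p) = prodPowHom R N n p := by
  rw [← AlgHom.comp_apply]
  congr 1
  refine algHom_ext fun i => ?_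
  cases i using Fin.cases with
  | zero =>
    rw [AlgHom.comp_apply, prodPowHom_X_zero, map_prod]
    simp only [aeval_X, Finset.prod_mul_distrib, ← map_prod, hd', map_one, one_mul]
  | succ j =>
    rw [AlgHom.comp_apply, prodPowHom_X_succ, map_pow, aeval_X, mul_pow, ← map_pow, hd, map_one,
      one_mul]

theorem IsPrimitiveRoot.modEq_of_prod_pow_eq_one {ι K : Type*} [Fintype ι] [Field K] {ζ : K}
    (hζ : IsPrimitiveRoot ζ N) (hN : 0 < N) (m : ι → ℕ)
    (h : ∀ d : ι → K, (∀ i, d i ^ N = 1) → ∏ i, d i = 1 → ∏ i, d i ^ m i = 1) (j k : ι) :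
    m j % N = m k % N := by
  classical
  rcases eq_or_ne j k with rfl | hjk
  · rfl
  have hζ0 : ζ ≠ 0 := hζ.ne_zero hN.ne'
  have key := h (Pi.mulSingle j ζ * Pi.mulSingle k ζ⁻¹) (fun i => ?_) ?_
  · simp only [Pi.mul_apply, mul_pow, Finset.prod_mul_distrib] at key
    have hs : ∀ (l : ι) (x : K), ∏ i, (Pi.mulSingle l x : ι → K) i ^ m i = x ^ m l := by
      intro l x
      rw [Finset.prod_eq_single l (fun b _ hb => by simp [hb]) (by simp), Pi.mulSingle_eq_same]
    rw [hs, hs, inv_pow, mul_inv_eq_one₀ (pow_ne_zero _ hζ0)] at key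
    rw [hζ.eq_orderOf, ← Units.val_mk0 hζ0, orderOf_units]
    exact (pow_inj_mod (x := Units.mk0 ζ hζ0)).1 (Units.ext (by simpa using key))
  · simp only [Pi.mul_apply, Pi.mulSingle_apply]
    split_ifs <;> simp [mul_pow, hζ.pow_eq_one]
  · simp [Finset.prod_mul_distrib, hζ0]

end

/-- For `r ≥ 1`, `n ≥ 2`, the `ℂ`-algebra map
`ℂ[x, y_1, …, y_n] → ℂ[Z_1,…,Z_n]`, `x ↦ Z_1⋯Z_n`, `y_j ↦ Z_j^(r+1)`, has image the
ring of `A_r(n)`-invariants and kernel the principal ideal `(x^(r+1) − y_1⋯y_n)`;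
so the invariant ring is the coordinate ring of the hypersurface
`x^(r+1) = y_1⋯y_n`. -/
theorem Ar_invariant_ring_presentation (r n : ℕ) (hr : 1 ≤ r) (hn : 2 ≤ n) :
    let φ : MvPolynomial (Fin (n + 1)) ℂ →ₐ[ℂ] MvPolynomial (Fin n) ℂ :=
      aeval (Fin.cons (∏ i, X i) fun j => (X j : MvPolynomial (Fin n) ℂ) ^ (r + 1))
    Set.range ⇑φ =
        {p : MvPolynomial (Fin n) ℂ |
          ∀ d : Fin n → ℂ, (∀ i, d i ^ (r + 1) = 1) → ∏ i, d i = 1 →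
            aeval (fun i => C (d i) * X i) p = p} ∧
      RingHom.ker φ =
        Ideal.span {(X 0 : MvPolynomial (Fin (n + 1)) ℂ) ^ (r + 1) -
          ∏ j : Fin n, X j.succ} := by
  intro φ
  let k : Fin n := ⟨0, by omega⟩
  refine ⟨Set.Subset.antisymm ?_ fun p hp => ?_, ker_prodPowHom r.succ_pos k⟩
  · rintro _ ⟨p, rfl⟩ d hd hd'
    exact aeval_C_mul_X_prodPowHom d hd hd' p
  · refine ⟨divModLinearMap ℂ (r + 1) k p, ?_⟩
    change prodPowHom ℂ (r + 1) n _ = p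
    conv_lhs => rw [p.as_sum]
    conv_rhs => rw [p.as_sum]
    rw [map_sum, map_sum]
    refine Finset.sum_congr rfl fun m hm =>
      prodPowHom_divModLinearMap_monomial k m _ fun j => ?_
    refine (Complex.isPrimitiveRoot_exp (r + 1) r.succ_ne_zero).modEq_of_prod_pow_eq_one
      r.succ_pos m (fun d hd hd' => ?_) j k
    have h := coeff_aeval_C_mul_X d m p
    rw [hp d hd hd'] at h
    exact (mul_eq_right₀ (mem_support_iff.1 hm)).1 h.symm
end

section
/- Let r ≥ 1 and let m_1, m_2, m_3 be non-negative integers with m_1 ≥ 1 and m_1 + m_2 + m_3 = r+1. The ideal I of ℂ[Z_1,Z_2,Z_3] generated by Z_1^{r+2-m_1}, Z_2^{r+1-m_2}, Z_3^{r+1-m_3}, (Z_1Z_2)^{m_3+1}, (Z_2Z_3)^{m_1}, (Z_3Z_1)^{m_2+1}, Z_1Z_2Z_3 is A_r(3)-invariant, the quotient ℂ[Z_1,Z_2,Z_3]/I has dimension (r+1)^2, and it is isomorphic to the regular representation of A_r(3), i.e. every character of A_r(3) occurs in it with multiplicity exactly one. -/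
open MvPolynomial

noncomputable section

/-- The abelian group `A_r(n)`: diagonal matrices (encoded as tuples of units)
`d` with `d i ^ (r+1) = 1` for all `i` and `∏ i, d i = 1` (determinant one). -/
def ArGroup (r n : ℕ) : Subgroup (Fin n → ℂˣ) where
  carrier := {d | (∀ i, d i ^ (r + 1) = 1) ∧ ∏ i, d i = 1}
  one_mem' := ⟨fun _ => one_pow _, Finset.prod_const_one⟩
  mul_mem' := by
    rintro a b ⟨ha1, ha2⟩ ⟨hb1, hb2⟩
    refine ⟨fun i => ?_, ?_⟩
    · simp [Pi.mul_apply, mul_pow, ha1 i, hb1 i]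
    · simp [Finset.prod_mul_distrib, ha2, hb2]
  inv_mem' := by
    rintro a ⟨ha1, ha2⟩
    refine ⟨fun i => ?_, ?_⟩
    · rw [Pi.inv_apply, inv_pow, ha1 i, inv_one]
    · simp [Finset.prod_inv_distrib, ha2]

/-- The action of a diagonal element `d` on polynomials, `Z i ↦ d i • Z i`. -/
def actA {n : ℕ} (d : Fin n → ℂˣ) :
    MvPolynomial (Fin n) ℂ →ₐ[ℂ] MvPolynomial (Fin n) ℂ :=
  aeval fun i => C (d i : ℂ) * X i

/-- The `ρ`-isotypic component (as a set) of the `A_r(n)`-module `ℂ[Z]/I`: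
those classes `w` such that for every `g` in the group and every representative `p`
of `w`, the class of `g · p` equals `ρ(g) • w`. -/
def iso (r n : ℕ) (I : Ideal (MvPolynomial (Fin n) ℂ)) (ρ : ArGroup r n →* ℂˣ) :
    Set (MvPolynomial (Fin n) ℂ ⧸ I) :=
  {w | ∀ g : ArGroup r n, ∀ p, Ideal.Quotient.mk I p = w →
    Ideal.Quotient.mk I (actA (g : Fin n → ℂˣ) p) = (ρ g : ℂ) • w}

end

/-- The exponents `(a, b, c)` of the monomials lying outside the ideal. -/
def IsStandardExponent (r m1 m2 m3 a b c : ℕ) : Prop :=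
  a < r + 2 - m1 ∧ b < r + 1 - m2 ∧ c < r + 1 - m3 ∧ (a ≤ m3 ∨ b ≤ m3) ∧
    (b < m1 ∨ c < m1) ∧ (c ≤ m2 ∨ a ≤ m2) ∧ (a = 0 ∨ b = 0 ∨ c = 0)

set_option maxHeartbeats 4000000 in
lemma isStandardExponent_unique {r m1 m2 m3 : ℕ} (hm1 : 1 ≤ m1) (hsum : m1 + m2 + m3 = r + 1)
    {a b c a' b' c' : ℕ} (h : IsStandardExponent r m1 m2 m3 a b c)
    (h' : IsStandardExponent r m1 m2 m3 a' b' c')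
    (hx : ((r + 1 : ℕ) : ℤ) ∣ ((a : ℤ) - c) - (a' - c'))
    (hy : ((r + 1 : ℕ) : ℤ) ∣ ((b : ℤ) - c) - (b' - c')) :
    a = a' ∧ b = b' ∧ c = c' := by
  obtain ⟨k, hk⟩ := hx
  obtain ⟨l, hl⟩ := hy
  obtain ⟨h1, h2, h3, h4, h5, h6, h7⟩ := h
  obtain ⟨h1', h2', h3', h4', h5', h6', h7'⟩ := h'
  have bound : ∀ t D : ℤ, D = ((r + 1 : ℕ) : ℤ) * t → D < 2 * ((r + 1 : ℕ) : ℤ) →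
      -(2 * ((r + 1 : ℕ) : ℤ)) < D → t = -1 ∨ t = 0 ∨ t = 1 := by
    intro t D hD h1 h2
    have hpos : (0 : ℤ) < ((r + 1 : ℕ) : ℤ) := by positivity
    have : t < 2 := by nlinarith
    have : -2 < t := by nlinarith
    omega
  have hk' := bound k _ hk (by omega) (by omega)
  have hl' := bound l _ hl (by omega) (by omega)
  rcases hk' with rfl | rfl | rfl <;> rcases hl' with rfl | rfl | rfl <;>
    rcases h7 with h7 | h7 | h7 <;> rcases h7' with h7' | h7' | h7' <;> omega

lemma exists_isStandardExponent {r m1 m2 m3 : ℕ} (hm1 : 1 ≤ m1) (hsum : m1 + m2 + m3 = r + 1)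
    {x y : ℕ} (hx : x < r + 1) (hy : y < r + 1) :
    ∃ a b c : ℕ, IsStandardExponent r m1 m2 m3 a b c ∧
      ((r + 1 : ℕ) : ℤ) ∣ ((a : ℤ) - c) - x ∧ ((r + 1 : ℕ) : ℤ) ∣ ((b : ℤ) - c) - y := by
  have key : ∀ a b c : ℕ, ∀ k l : ℤ, IsStandardExponent r m1 m2 m3 a b c →
      ((a : ℤ) - c) - x = ((r + 1 : ℕ) : ℤ) * k → ((b : ℤ) - c) - y = ((r + 1 : ℕ) : ℤ) * l →
      ∃ a b c : ℕ, IsStandardExponent r m1 m2 m3 a b c ∧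
      ((r + 1 : ℕ) : ℤ) ∣ ((a : ℤ) - c) - x ∧ ((r + 1 : ℕ) : ℤ) ∣ ((b : ℤ) - c) - y :=
    fun a b c k l h h1 h2 => ⟨a, b, c, h, ⟨k, h1⟩, ⟨l, h2⟩⟩
  unfold IsStandardExponent at key
  by_cases hc : x < r + 2 - m1 ∧ y < r + 1 - m2 ∧ (x ≤ m3 ∨ y ≤ m3)
  · exact key x y 0 0 0 (by omega) (by omega) (by omega)
  by_cases hxy : y ≤ x
  · by_cases hy0 : y = 0
    · exact key 0 (r + 1 - x) (r + 1 - x) (-1) 0 (by omega) (by omega) (by omega)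
    by_cases hb : x - y < r + 2 - m1 ∧ r + 1 - y < r + 1 - m3 ∧ (r + 1 - y ≤ m2 ∨ x - y ≤ m2)
    · exact key (x - y) 0 (r + 1 - y) (-1) (-1) (by omega) (by omega) (by omega)
    by_cases hxy' : x = y
    · exact key 0 0 (r + 1 - x) (-1) (-1) (by omega) (by omega) (by omega)
    · exact key 0 (y + (r + 1) - x) (r + 1 - x) (-1) 0 (by omega) (by omega) (by omega)
  · by_cases hx0 : x = 0
    · exact key (r + 1 - y) 0 (r + 1 - y) 0 (-1) (by omega) (by omega) (by omega)
    by_cases hb : y - x < r + 1 - m2 ∧ r + 1 - x < r + 1 - m3 ∧ (y - x < m1 ∨ r + 1 - x < m1)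
    · exact key 0 (y - x) (r + 1 - x) (-1) (-1) (by omega) (by omega) (by omega)
    · exact key (x + (r + 1) - y) 0 (r + 1 - y) 0 (-1) (by omega) (by omega) (by omega)

lemma coeff_actA {n : ℕ} (d : Fin n → ℂˣ) (p : MvPolynomial (Fin n) ℂ) (s : Fin n →₀ ℕ) :
    coeff s (actA d p) = (∏ i, (d i : ℂ) ^ s i) * coeff s p := by
  induction p using MvPolynomial.induction_on' with
  | monomial u a =>
    have : actA d (monomial u a) = monomial u ((∏ i, (d i : ℂ) ^ u i) * a) := by
      rw [actA, aeval_monomial, Finsupp.prod_fintype _ _ (by simp), monomial_eq (s := u),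
        Finsupp.prod_fintype _ _ (by simp)]
      simp only [mul_pow, Finset.prod_mul_distrib, algebraMap_eq, C_mul, map_prod, C_pow]
      ring
    rw [this, coeff_monomial, coeff_monomial]
    split_ifs with h
    · rw [h]
    · simp
  | add p q hp hq => rw [map_add, coeff_add, hp, hq, coeff_add, mul_add]

section MonomialQuotient

variable {n : ℕ} {I : Ideal (MvPolynomial (Fin n) ℂ)} {S : Set (Fin n →₀ ℕ)}

lemma finrank_quotient_of_mem_iff_coeff [Finite S]
    (hI : ∀ p, p ∈ I ↔ ∀ s ∈ S, coeff s p = 0) :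
    Module.finrank ℂ (MvPolynomial (Fin n) ℂ ⧸ I) = Nat.card S := by
  classical
  have := Fintype.ofFinite S
  let L : MvPolynomial (Fin n) ℂ →ₗ[ℂ] (S → ℂ) := LinearMap.pi fun s => lcoeff ℂ (s : Fin n →₀ ℕ)
  have hL : Function.Surjective L := fun f =>
    ⟨∑ s : S, monomial (s : Fin n →₀ ℕ) (f s), by
      ext t
      simp [L, coeff_monomial, Subtype.coe_inj]⟩
  have hker : I.restrictScalars ℂ = LinearMap.ker L := by
    ext p
    rw [Submodule.restrictScalars_mem, hI, LinearMap.mem_ker, funext_iff]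
    simp [L]
  have e := (Submodule.Quotient.restrictScalarsEquiv ℂ I).symm ≪≫ₗ
    Submodule.quotEquivOfEq _ _ hker ≪≫ₗ L.quotKerEquivOfSurjective hL
  rw [e.finrank_eq, Module.finrank_fintype_fun_eq_card, Nat.card_eq_fintype_card]

lemma exists_generator_iso {r : ℕ} (hI : ∀ p, p ∈ I ↔ ∀ s ∈ S, coeff s p = 0)
    (ρ : ArGroup r n →* ℂˣ) {s : Fin n →₀ ℕ} (hs : s ∈ S)
    (hρ : ∀ t ∈ S, (∀ g : ArGroup r n, ∏ i, (g : Fin n → ℂˣ) i ^ t i = ρ g) ↔ t = s) :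
    ∃ w ∈ iso r n I ρ, w ≠ 0 ∧ ∀ w' ∈ iso r n I ρ, ∃ a : ℂ, w' = a • w := by
  classical
  have hsmul (a : ℂ) (p : MvPolynomial (Fin n) ℂ) :
      a • Ideal.Quotient.mk I p = Ideal.Quotient.mk I (a • p) := rfl
  refine ⟨Ideal.Quotient.mk I (monomial s 1), ?_, ?_, ?_⟩
  · intro g p hp
    rw [← hp, hsmul, Ideal.Quotient.eq, hI]
    rw [Ideal.Quotient.eq, hI] at hp
    intro t ht
    have h := hp t ht
    rw [coeff_sub, coeff_monomial] at h
    rw [coeff_sub, coeff_actA, coeff_smul, smul_eq_mul]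
    by_cases hts : t = s
    · rw [← (hρ t ht).2 hts g]
      simp
    · rw [if_neg (Ne.symm hts), sub_zero] at h
      simp [h]
  · rw [Ne, Ideal.Quotient.eq_zero_iff_mem, hI]
    intro h
    simpa using h s hs
  · intro w' hw'
    obtain ⟨p, rfl⟩ := Ideal.Quotient.mk_surjective w'
    refine ⟨coeff s p, ?_⟩
    rw [hsmul, Ideal.Quotient.eq, hI]
    intro t ht
    rw [coeff_sub, coeff_smul, coeff_monomial]
    split_ifs with hst
    · simp [hst]
    · have hne : ¬ ∀ g : ArGroup r n, ∏ i, (g : Fin n → ℂˣ) i ^ t i = ρ g :=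
        fun h => hst ((hρ t ht).1 h).symm
      push Not at hne
      obtain ⟨g, hg⟩ := hne
      have h := hw' g p rfl
      rw [hsmul, Ideal.Quotient.eq, hI] at h
      have h := h t ht
      rw [coeff_sub, coeff_actA, coeff_smul, smul_eq_mul, ← sub_mul] at h
      have hg' : (∏ i, ((g : Fin n → ℂˣ) i : ℂ) ^ t i) - ρ g ≠ 0 := fun h0 =>
        hg (Units.ext (by simpa using sub_eq_zero.1 h0))
      simpa using (mul_eq_zero.1 h).resolve_left hg'

end MonomialQuotient

lemma mem_span_iff_coeff_isStandardExponent (r m1 m2 m3 : ℕ) (p : MvPolynomial (Fin 3) ℂ) :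
    p ∈ Ideal.span {(X 0 : MvPolynomial (Fin 3) ℂ) ^ (r + 2 - m1),
        X 1 ^ (r + 1 - m2), X 2 ^ (r + 1 - m3),
        (X 0 * X 1) ^ (m3 + 1), (X 1 * X 2) ^ m1, (X 2 * X 0) ^ (m2 + 1),
        X 0 * X 1 * X 2} ↔
      ∀ s ∈ {s : Fin 3 →₀ ℕ | IsStandardExponent r m1 m2 m3 (s 0) (s 1) (s 2)},
        coeff s p = 0 := by
  let e (a b c : ℕ) : Fin 3 →₀ ℕ := Finsupp.equivFunOnFinite.symm ![a, b, c]
  have he (a b c : ℕ) : (monomial (e a b c) 1 : MvPolynomial (Fin 3) ℂ)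
      = X 0 ^ a * X 1 ^ b * X 2 ^ c := by
    rw [monomial_eq, Finsupp.prod_fintype _ _ (by simp), Fin.prod_univ_three]
    simp [e]
  have hle (a b c : ℕ) (s : Fin 3 →₀ ℕ) : e a b c ≤ s ↔ a ≤ s 0 ∧ b ≤ s 1 ∧ c ≤ s 2 := by
    rw [Finsupp.le_def, Fin.forall_fin_succ, Fin.forall_fin_two]
    simp [e]
  have hset : ({(X 0 : MvPolynomial (Fin 3) ℂ) ^ (r + 2 - m1),
        X 1 ^ (r + 1 - m2), X 2 ^ (r + 1 - m3),
        (X 0 * X 1) ^ (m3 + 1), (X 1 * X 2) ^ m1, (X 2 * X 0) ^ (m2 + 1),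
        X 0 * X 1 * X 2} : Set (MvPolynomial (Fin 3) ℂ)) =
      (fun s => monomial s (1 : ℂ)) '' {e (r + 2 - m1) 0 0, e 0 (r + 1 - m2) 0,
        e 0 0 (r + 1 - m3), e (m3 + 1) (m3 + 1) 0, e 0 m1 m1, e (m2 + 1) 0 (m2 + 1),
        e 1 1 1} := by
    simp only [Set.image_insert_eq, Set.image_singleton, he, pow_zero, mul_one, one_mul, mul_pow,
      pow_one]
    rw [mul_comm (X 2 ^ (m2 + 1) : MvPolynomial (Fin 3) ℂ)]
  rw [hset, mem_ideal_span_monomial_image]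
  have hstd (s : Fin 3 →₀ ℕ) : (∃ t ∈ ({e (r + 2 - m1) 0 0, e 0 (r + 1 - m2) 0,
        e 0 0 (r + 1 - m3), e (m3 + 1) (m3 + 1) 0, e 0 m1 m1, e (m2 + 1) 0 (m2 + 1),
        e 1 1 1} : Set (Fin 3 →₀ ℕ)), t ≤ s) ↔
      ¬ IsStandardExponent r m1 m2 m3 (s 0) (s 1) (s 2) := by
    simp only [Set.mem_insert_iff, Set.mem_singleton_iff, exists_eq_or_imp, exists_eq_left, hle,
      IsStandardExponent]
    omega
  simp only [hstd, mem_support_iff, Set.mem_ofPred_eq]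
  exact forall_congr' fun s => by tauto

lemma bijective_residues {r m1 m2 m3 : ℕ} (hm1 : 1 ≤ m1) (hsum : m1 + m2 + m3 = r + 1) :
    Function.Bijective
      fun s : {s : Fin 3 →₀ ℕ | IsStandardExponent r m1 m2 m3 (s 0) (s 1) (s 2)} =>
        (((s.1 0 : ZMod (r + 1)) - s.1 2, (s.1 1 : ZMod (r + 1)) - s.1 2) :
          ZMod (r + 1) × ZMod (r + 1)) := by
  constructor
  · rintro ⟨s, hs⟩ ⟨t, ht⟩ h
    simp only [Prod.mk.injEq] at h
    obtain ⟨h0, h1, h2⟩ := isStandardExponent_unique hm1 hsum hs ht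
      ((ZMod.intCast_zmod_eq_zero_iff_dvd _ _).1 (by push_cast; exact sub_eq_zero.2 h.1))
      ((ZMod.intCast_zmod_eq_zero_iff_dvd _ _).1 (by push_cast; exact sub_eq_zero.2 h.2))
    ext i
    fin_cases i
    exacts [h0, h1, h2]
  · rintro ⟨x, y⟩
    obtain ⟨a, b, c, h, hx, hy⟩ :=
      exists_isStandardExponent hm1 hsum (ZMod.val_lt x) (ZMod.val_lt y)
    refine ⟨⟨Finsupp.equivFunOnFinite.symm ![a, b, c], by simpa using h⟩, ?_⟩
    rw [← ZMod.intCast_zmod_eq_zero_iff_dvd] at hx hy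
    push_cast at hx hy
    rw [ZMod.natCast_zmod_val, sub_eq_zero] at hx hy
    simp [hx, hy]

/-- The characters of `A_r(3)` are those of the monomials, and the character of
`Z_1^a Z_2^b Z_3^c` is determined by the residues of `a - c` and `b - c` modulo `r + 1`. -/
lemma exists_residues_iff_eq_character (r : ℕ) (ρ : ArGroup r 3 →* ℂˣ) :
    ∃ x y : ZMod (r + 1), ∀ t : Fin 3 →₀ ℕ,
      (∀ g : ArGroup r 3, ∏ i, (g : Fin 3 → ℂˣ) i ^ t i = ρ g) ↔
        (t 0 : ZMod (r + 1)) - t 2 = x ∧ (t 1 : ZMod (r + 1)) - t 2 = y := by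
  obtain ⟨ζ, hζ⟩ : ∃ ζ : ℂˣ, IsPrimitiveRoot ζ (r + 1) :=
    ⟨_, (Complex.isPrimitiveRoot_exp (r + 1) r.succ_ne_zero).isUnit_unit r.succ_ne_zero⟩
  let g₁ : ArGroup r 3 := ⟨![ζ, 1, ζ⁻¹], by
    refine ⟨?_, by simp [Fin.prod_univ_three]⟩
    simp [Fin.forall_fin_succ, hζ.pow_eq_one]⟩
  let g₂ : ArGroup r 3 := ⟨![1, ζ, ζ⁻¹], by
    refine ⟨?_, by simp [Fin.prod_univ_three]⟩
    simp [Fin.forall_fin_succ, hζ.pow_eq_one]⟩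
  have hpow (u : ℂˣ) (hu : u ^ (r + 1) = 1) : ∃ i : ℕ, ζ ^ i = u := by
    obtain ⟨i, -, hi⟩ := (IsPrimitiveRoot.coe_units_iff.2 hζ).eq_pow_of_pow_eq_one
      (ξ := (u : ℂ)) (by rw [← Units.val_pow_eq_pow_val, hu, Units.val_one])
    exact ⟨i, Units.ext (by simpa using hi)⟩
  have hgen (g : ArGroup r 3) : ∃ i j : ℕ, g = g₁ ^ i * g₂ ^ j := by
    obtain ⟨i, hi⟩ := hpow _ (g.2.1 0)
    obtain ⟨j, hj⟩ := hpow _ (g.2.1 1)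
    have h := g.2.2
    rw [Fin.prod_univ_three, ← hi, ← hj] at h
    refine ⟨i, j, Subtype.ext (funext fun k => ?_)⟩
    fin_cases k
    · simp [g₁, g₂, hi]
    · simp [g₁, g₂, hj]
    · change (g : Fin 3 → ℂˣ) 2 = ζ⁻¹ ^ i * ζ⁻¹ ^ j
      rw [eq_inv_of_mul_eq_one_right h, mul_inv, inv_pow, inv_pow]
  let χ (t : Fin 3 →₀ ℕ) : ArGroup r 3 →* ℂˣ :=
    { toFun := fun g => ∏ i, (g : Fin 3 → ℂˣ) i ^ t i
      map_one' := by simp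
      map_mul' := fun g h => by simp [mul_pow, Finset.prod_mul_distrib] }
  have hρ (g : ArGroup r 3) (hg : g ^ (r + 1) = 1) : ∃ i : ℕ, ζ ^ i = ρ g :=
    hpow _ (by rw [← map_pow, hg, map_one])
  have hord (g : ArGroup r 3) : g ^ (r + 1) = 1 :=
    Subtype.ext (funext fun i => g.2.1 i)
  obtain ⟨i, hi⟩ := hρ g₁ (hord g₁)
  obtain ⟨j, hj⟩ := hρ g₂ (hord g₂)
  have hval (a c i : ℕ) : ζ ^ a * ζ⁻¹ ^ c = ζ ^ i ↔ (a : ZMod (r + 1)) - c = i := by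
    rw [inv_pow, mul_inv_eq_iff_eq_mul, ← pow_add, sub_eq_iff_eq_add, ← Nat.cast_add,
      ZMod.natCast_eq_natCast_iff, pow_eq_pow_iff_modEq, hζ.eq_orderOf]
  refine ⟨i, j, fun t => ?_⟩
  have h₁ : χ t g₁ = ζ ^ t 0 * ζ⁻¹ ^ t 2 := by simp [χ, g₁, Fin.prod_univ_three]
  have h₂ : χ t g₂ = ζ ^ t 1 * ζ⁻¹ ^ t 2 := by simp [χ, g₂, Fin.prod_univ_three]
  rw [← hval, ← hval, ← h₁, ← h₂, hi, hj]
  refine ⟨fun h => ⟨h g₁, h g₂⟩, fun h g => ?_⟩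
  obtain ⟨k, l, rfl⟩ := hgen g
  change χ t _ = _
  rw [map_mul, map_mul, map_pow, map_pow, map_pow, map_pow, h.1, h.2]

/-- For `m_1 ≥ 1`, `m_1 + m_2 + m_3 = r+1`, the monomial ideal
`⟨Z_1^(r+2−m_1), Z_2^(r+1−m_2), Z_3^(r+1−m_3), (Z_1Z_2)^(m_3+1), (Z_2Z_3)^(m_1),
(Z_3Z_1)^(m_2+1), Z_1Z_2Z_3⟩` is `A_r(3)`-invariant, the quotient has dimension
`(r+1)^2`, and every character of `A_r(3)` occurs in it with multiplicity one. -/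
theorem Ar3_monomial_ideal_u_regular (r m1 m2 m3 : ℕ) (hr : 1 ≤ r) (hm1 : 1 ≤ m1)
    (hsum : m1 + m2 + m3 = r + 1) :
    let I : Ideal (MvPolynomial (Fin 3) ℂ) :=
      Ideal.span {(X 0 : MvPolynomial (Fin 3) ℂ) ^ (r + 2 - m1),
        X 1 ^ (r + 1 - m2), X 2 ^ (r + 1 - m3),
        (X 0 * X 1) ^ (m3 + 1), (X 1 * X 2) ^ m1, (X 2 * X 0) ^ (m2 + 1),
        X 0 * X 1 * X 2}
    (∀ g : ArGroup r 3, ∀ p ∈ I, actA (g : Fin 3 → ℂˣ) p ∈ I) ∧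
    Module.finrank ℂ (MvPolynomial (Fin 3) ℂ ⧸ I) = (r + 1) ^ 2 ∧
    ∀ ρ : ArGroup r 3 →* ℂˣ,
      ∃ w ∈ iso r 3 I ρ, w ≠ 0 ∧ ∀ w' ∈ iso r 3 I ρ, ∃ a : ℂ, w' = a • w := by
  intro I
  have hI := mem_span_iff_coeff_isStandardExponent r m1 m2 m3
  have hbij := bijective_residues hm1 hsum
  refine ⟨fun g p hp => ?_, ?_, fun ρ => ?_⟩
  · rw [hI] at hp ⊢
    intro s hs
    rw [coeff_actA, hp s hs, mul_zero]
  · have := Finite.of_injective _ hbij.1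
    rw [finrank_quotient_of_mem_iff_coeff hI, Nat.card_eq_of_bijective _ hbij, Nat.card_prod,
      Nat.card_zmod, sq]
  · obtain ⟨x, y, hxy⟩ := exists_residues_iff_eq_character r ρ
    obtain ⟨s, hs⟩ := hbij.2 (x, y)
    refine exists_generator_iso hI ρ s.2 fun t ht => ?_
    rw [hxy, ← Prod.mk.injEq, ← hs]
    exact (hbij.1.eq_iff (a := ⟨t, ht⟩)).trans Subtype.ext_iff
end

section
/- Let r ≥ 1 and let J be an ideal of ℂ[Z_1,Z_2,Z_3] generated by monomials, containing the ideal I(o) = ⟨Z_1^{r+1}, Z_2^{r+1}, Z_3^{r+1}, Z_1Z_2Z_3⟩, such that the A_r(3)-module ℂ[Z_1,Z_2,Z_3]/J is isomorphic to the regular representation of A_r(3). For i = 1,2,3 let l_i be the smallest non-negative integer with Z_i^{l_i} ∈ J, and for i ≠ j let l_{i,j} be the smallest non-negative integer with (Z_iZ_j)^{l_{i,j}} ∈ J. Then 1 ≤ l_i ≤ r+1 for each i, and l_1 + l_{2,3} = l_2 + l_{1,3} = l_3 + l_{1,2} = r+2. -/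
open MvPolynomial

/-- The character through which `ArGroup r n` acts on the monomial with exponent `m`. -/
noncomputable def monomialCharacter (r n : ℕ) (m : Fin n →₀ ℕ) : ArGroup r n →* ℂˣ where
  toFun g := ∏ i, (g : Fin n → ℂˣ) i ^ m i
  map_one' := by simp
  map_mul' g h := by simp [mul_pow, Finset.prod_mul_distrib]

/-- An ideal generated by monomials. -/
def IsMonomialIdeal {n : ℕ} (J : Ideal (MvPolynomial (Fin n) ℂ)) : Prop :=
  ∃ T : Set (Fin n →₀ ℕ),
    J = Ideal.span ((fun m => (monomial m (1 : ℂ) : MvPolynomial (Fin n) ℂ)) '' T)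

theorem monomial_mem_of_le {n : ℕ} {J : Ideal (MvPolynomial (Fin n) ℂ)} {m m' : Fin n →₀ ℕ}
    (hle : m ≤ m') (hm : (monomial m (1 : ℂ) : MvPolynomial (Fin n) ℂ) ∈ J) :
    (monomial m' (1 : ℂ) : MvPolynomial (Fin n) ℂ) ∈ J := by
  have h : (monomial m' (1 : ℂ) : MvPolynomial (Fin n) ℂ) =
      monomial (m' - m) 1 * monomial m 1 := by
    rw [monomial_mul, tsub_add_cancel_of_le hle, one_mul]
  rw [h]
  exact J.mul_mem_left _ hm

theorem IsMonomialIdeal.mem_iff {n : ℕ} {J : Ideal (MvPolynomial (Fin n) ℂ)}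
    (hJ : IsMonomialIdeal J) (p : MvPolynomial (Fin n) ℂ) :
    p ∈ J ↔ ∀ m, coeff m p ≠ 0 → (monomial m (1 : ℂ) : MvPolynomial (Fin n) ℂ) ∈ J := by
  obtain ⟨T, rfl⟩ := hJ
  rw [mem_ideal_span_monomial_image]
  simp only [mem_support_iff]
  refine forall₂_congr fun m _ => ⟨?_, fun h => ?_⟩
  · rintro ⟨t, ht, hle⟩
    exact monomial_mem_of_le hle (Ideal.subset_span ⟨t, ht, rfl⟩)
  · exact mem_ideal_span_monomial_image.1 h m (by simp)

theorem coeff_actA_s10 {r n : ℕ} (g : ArGroup r n) (p : MvPolynomial (Fin n) ℂ) (m : Fin n →₀ ℕ) :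
    coeff m (actA (g : Fin n → ℂˣ) p) = (monomialCharacter r n m g : ℂ) * coeff m p := by
  induction p using MvPolynomial.induction_on' with
  | monomial u a =>
    have h : actA (g : Fin n → ℂˣ) (monomial u a) =
        monomial u ((monomialCharacter r n u g : ℂ) * a) := by
      rw [actA, aeval_monomial, Finsupp.prod_fintype _ _ (by simp)]
      simp only [mul_pow, Finset.prod_mul_distrib, ← map_pow, ← map_prod]
      rw [monomial_eq, Finsupp.prod_fintype _ _ (by simp)]
      simp only [monomialCharacter, MonoidHom.coe_mk, OneHom.coe_mk, algebraMap_eq, C_mul,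
        Units.coe_prod, Units.val_pow_eq_pow_val]
      ring
    rw [h, coeff_monomial, coeff_monomial]
    split_ifs with hu
    · rw [hu]
    · simp
  | add p q hp hq => rw [map_add, coeff_add, coeff_add, hp, hq, mul_add]

theorem IsMonomialIdeal.actA_mem {r n : ℕ} {J : Ideal (MvPolynomial (Fin n) ℂ)}
    (hJ : IsMonomialIdeal J) (g : ArGroup r n) {p : MvPolynomial (Fin n) ℂ} (hp : p ∈ J) :
    actA (g : Fin n → ℂˣ) p ∈ J := by
  rw [hJ.mem_iff] at hp ⊢
  intro m hm
  rw [coeff_actA_s10] at hm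
  exact hp m (right_ne_zero_of_mul hm)

theorem actA_monomial {r n : ℕ} (g : ArGroup r n) (m : Fin n →₀ ℕ) :
    actA (g : Fin n → ℂˣ) (monomial m 1) =
      (monomialCharacter r n m g : ℂ) • monomial m (1 : ℂ) := by
  ext u
  rw [coeff_actA_s10, coeff_smul, coeff_monomial, smul_eq_mul]
  split_ifs with hu
  · rw [hu]
  · simp

theorem IsMonomialIdeal.mk_monomial_mem_iso {r n : ℕ} {J : Ideal (MvPolynomial (Fin n) ℂ)}
    (hJ : IsMonomialIdeal J) (m : Fin n →₀ ℕ) :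
    Ideal.Quotient.mk J (monomial m 1) ∈ iso r n J (monomialCharacter r n m) := by
  intro g p hp
  have h : Ideal.Quotient.mk J (actA (g : Fin n → ℂˣ) p) =
      Ideal.Quotient.mk J (actA (g : Fin n → ℂˣ) (monomial m 1)) := by
    rw [Ideal.Quotient.eq] at hp ⊢
    rw [← map_sub]
    exact hJ.actA_mem g hp
  rw [h, actA_monomial]
  rfl

/-- Each character occurring in `ℂ[Z]/J` is the character of a monomial outside `J`. -/
theorem IsMonomialIdeal.exists_monomial_notMem {r n : ℕ} {J : Ideal (MvPolynomial (Fin n) ℂ)}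
    (hJ : IsMonomialIdeal J) {ρ : ArGroup r n →* ℂˣ} {w : MvPolynomial (Fin n) ℂ ⧸ J}
    (hw : w ∈ iso r n J ρ) (hw0 : w ≠ 0) :
    ∃ m, (monomial m (1 : ℂ) : MvPolynomial (Fin n) ℂ) ∉ J ∧ monomialCharacter r n m = ρ := by
  obtain ⟨p, rfl⟩ := Ideal.Quotient.mk_surjective w
  rw [Ne, Ideal.Quotient.eq_zero_iff_mem, hJ.mem_iff] at hw0
  push Not at hw0
  obtain ⟨m, hm, hmJ⟩ := hw0
  refine ⟨m, hmJ, ?_⟩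
  ext g
  have h : Ideal.Quotient.mk J (actA (g : Fin n → ℂˣ) p) =
      Ideal.Quotient.mk J ((ρ g : ℂ) • p) := hw g p rfl
  rw [Ideal.Quotient.eq, hJ.mem_iff] at h
  by_contra hne
  refine hmJ (h m ?_)
  rw [coeff_sub, coeff_actA_s10, coeff_smul, smul_eq_mul, ← sub_mul]
  exact mul_ne_zero (sub_ne_zero.2 hne) hm

/-- Monomials outside `J` with the same character coincide when the corresponding isotypic
component is at most one-dimensional. -/
theorem IsMonomialIdeal.eq_of_monomialCharacter_eq {r n : ℕ}
    {J : Ideal (MvPolynomial (Fin n) ℂ)} (hJ : IsMonomialIdeal J) {m m' : Fin n →₀ ℕ}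
    (hm : (monomial m (1 : ℂ) : MvPolynomial (Fin n) ℂ) ∉ J)
    (hm' : (monomial m' (1 : ℂ) : MvPolynomial (Fin n) ℂ) ∉ J)
    (hχ : monomialCharacter r n m = monomialCharacter r n m')
    (hdim : ∃ w : MvPolynomial (Fin n) ℂ ⧸ J,
      ∀ w' ∈ iso r n J (monomialCharacter r n m), ∃ a : ℂ, w' = a • w) :
    m = m' := by
  obtain ⟨w, hw⟩ := hdim
  obtain ⟨a, ha⟩ := hw _ (hJ.mk_monomial_mem_iso m)
  obtain ⟨b, hb⟩ := hw _ (hχ ▸ hJ.mk_monomial_mem_iso m')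
  have hb0 : b ≠ 0 := by
    rintro rfl
    exact hm' (Ideal.Quotient.eq_zero_iff_mem.1 (by rw [hb, zero_smul]))
  have h : Ideal.Quotient.mk J (b • monomial m 1) = Ideal.Quotient.mk J (a • monomial m' 1) := by
    change b • Ideal.Quotient.mk J (monomial m 1) = a • Ideal.Quotient.mk J (monomial m' 1)
    rw [ha, hb, smul_comm]
  rw [Ideal.Quotient.eq, hJ.mem_iff] at h
  by_contra hne
  refine hm (h m ?_)
  rw [coeff_sub, coeff_smul, coeff_smul, coeff_monomial, coeff_monomial, if_pos rfl,
    if_neg (Ne.symm hne)]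
  simpa using hb0

theorem monomialCharacter_modEq {r n : ℕ} {m m' : Fin n →₀ ℕ}
    (h : monomialCharacter r n m = monomialCharacter r n m') (i j : Fin n) :
    m i + m' j ≡ m' i + m j [MOD r + 1] := by
  have hζ := Complex.isPrimitiveRoot_exp (r + 1) r.succ_ne_zero
  obtain ⟨ζ, hζ⟩ : ∃ ζ : ℂˣ, IsPrimitiveRoot ζ (r + 1) :=
    ⟨_, hζ.isUnit_unit r.succ_ne_zero⟩
  let d : Fin n → ℂˣ := Pi.mulSingle i ζ * Pi.mulSingle j ζ⁻¹
  have hd : d ∈ ArGroup r n := by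
    refine ⟨fun x => ?_, ?_⟩
    · have h1 : d ^ (r + 1) = 1 := by
        simp only [d, mul_pow, ← Pi.mulSingle_pow, inv_pow, hζ.pow_eq_one]
        simp
      exact congrFun h1 x
    · simp [d, Finset.prod_mul_distrib]
  have key (u : Fin n →₀ ℕ) :
      monomialCharacter r n u ⟨d, hd⟩ = ζ ^ u i * (ζ ^ u j)⁻¹ := by
    have hs (k : Fin n) (z : ℂˣ) : ∏ x, (Pi.mulSingle k z : Fin n → ℂˣ) x ^ u x = z ^ u k := by
      rw [Finset.prod_eq_single k]
      · simp
      · intro x _ hx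
        simp [Pi.mulSingle_eq_of_ne hx]
      · simp
    simp only [monomialCharacter, MonoidHom.coe_mk, OneHom.coe_mk, d, Pi.mul_apply, mul_pow,
      Finset.prod_mul_distrib, hs, inv_pow]
  have h2 := DFunLike.congr_fun h ⟨d, hd⟩
  rw [key, key, mul_inv_eq_iff_eq_mul, mul_right_comm, eq_mul_inv_iff_mul_eq, ← pow_add,
    ← pow_add, pow_eq_pow_iff_modEq, ← hζ.eq_orderOf] at h2
  exact h2

theorem monomialCharacter_single_eq {r a b : ℕ} (hab : a + b = r + 1) {i j k : Fin 3}
    (hij : i ≠ j) (hik : i ≠ k) (hjk : j ≠ k) :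
    monomialCharacter r 3 (Finsupp.single i a) =
      monomialCharacter r 3 (Finsupp.single j b + Finsupp.single k b) := by
  have huniv : (Finset.univ : Finset (Fin 3)) = {i, j, k} := by
    revert i j k
    decide
  refine MonoidHom.ext fun g => ?_
  obtain ⟨g, hg1, hg2⟩ := g
  simp only [monomialCharacter, MonoidHom.coe_mk, OneHom.coe_mk]
  rw [huniv, Finset.prod_insert (by simp [hij, hik]), Finset.prod_pair hjk] at hg2 ⊢
  rw [Finset.prod_insert (by simp [hij, hik]), Finset.prod_pair hjk]
  simp only [Finsupp.add_apply, Finsupp.single_apply, hij, hik, hjk, hij.symm, hik.symm, hjk.symm,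
    if_true, if_false, pow_zero, mul_one, one_mul, add_zero, zero_add]
  rw [← mul_pow]
  calc g i ^ a = g i ^ a * (g i * (g j * g k)) ^ b := by rw [hg2, one_pow, mul_one]
    _ = g i ^ (a + b) * (g j * g k) ^ b := by rw [mul_pow, pow_add, mul_assoc]
    _ = (g j * g k) ^ b := by rw [hab, hg1, one_mul]

theorem X_mul_X_pow_eq_monomial (j k : Fin 3) (b : ℕ) :
    ((X j : MvPolynomial (Fin 3) ℂ) * X k) ^ b =
      monomial (Finsupp.single j b + Finsupp.single k b) 1 := by
  rw [mul_pow, X_pow_eq_monomial, X_pow_eq_monomial, monomial_mul, one_mul]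

/-- If `ℂ[Z]/J` is the regular representation then, for `a + b = r + 1` with `a, b` positive,
exactly one of `Z_i ^ a` and `(Z_j Z_k) ^ b` lies in `J`. -/
theorem IsMonomialIdeal.X_pow_mem_iff {r : ℕ} {J : Ideal (MvPolynomial (Fin 3) ℂ)}
    (hJ : IsMonomialIdeal J) (hpow : ∀ i, (X i : MvPolynomial (Fin 3) ℂ) ^ (r + 1) ∈ J)
    (hreg : ∀ ρ : ArGroup r 3 →* ℂˣ,
      ∃ w ∈ iso r 3 J ρ, w ≠ 0 ∧ ∀ w' ∈ iso r 3 J ρ, ∃ a : ℂ, w' = a • w)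
    {i j k : Fin 3} (hij : i ≠ j) (hik : i ≠ k) (hjk : j ≠ k)
    (hprod : (X i : MvPolynomial (Fin 3) ℂ) * (X j * X k) ∈ J)
    {a b : ℕ} (ha : 1 ≤ a) (hb : 1 ≤ b) (hab : a + b = r + 1) :
    (X i : MvPolynomial (Fin 3) ℂ) ^ a ∈ J ↔ ((X j : MvPolynomial (Fin 3) ℂ) * X k) ^ b ∉ J := by
  have hcases : ∀ x, x = i ∨ x = j ∨ x = k := by
    clear hprod
    revert i j k
    decide
  have hχ := monomialCharacter_single_eq hab hij hik hjk
  obtain ⟨w, hw, hw0, hw1⟩ := hreg (monomialCharacter r 3 (Finsupp.single i a))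
  rw [X_pow_eq_monomial, X_mul_X_pow_eq_monomial]
  constructor
  · intro hi hjk_mem
    obtain ⟨m, hm, hmχ⟩ := hJ.exists_monomial_notMem hw hw0
    have hlt (x : Fin 3) : m x < r + 1 := by
      by_contra! hx
      have h := hpow x
      rw [X_pow_eq_monomial] at h
      exact hm (monomial_mem_of_le (Finsupp.single_le_iff.2 hx) h)
    have hmj : m j = m k := by
      have h := monomialCharacter_modEq hmχ j k
      simp only [Finsupp.single_apply, hij, hik, if_false, add_zero, zero_add] at h
      exact h.eq_of_lt_of_lt (hlt j) (hlt k)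
    have hmi := monomialCharacter_modEq hmχ i j
    simp only [Finsupp.single_apply, hij, if_true, if_false, add_zero] at hmi
    by_cases hj0 : m j = 0
    · rw [hj0, add_zero] at hmi
      have hma := hmi.eq_of_lt_of_lt (hlt i) (by omega)
      exact hm (monomial_mem_of_le (Finsupp.single_le_iff.2 hma.ge) hi)
    · have hi0 : m i = 0 := by
        by_contra hi0
        have hp : (X i : MvPolynomial (Fin 3) ℂ) * (X j * X k) =
            monomial (Finsupp.single i 1 + (Finsupp.single j 1 + Finsupp.single k 1)) 1 := by
          simp only [X, monomial_mul, one_mul]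
        rw [hp] at hprod
        refine hm (monomial_mem_of_le (fun x => ?_) hprod)
        rcases hcases x with rfl | rfl | rfl <;>
          simp [*, Ne.symm] <;> omega
      rw [hi0] at hmi
      have hdvd : r + 1 ∣ a + m j := (Nat.modEq_zero_iff_dvd).1 hmi.symm
      have hjb : b = m j := by
        obtain ⟨c, hc⟩ := hdvd
        have hj := hlt j
        have hc1 : c = 1 := by
          have h1 : 0 < c := Nat.pos_of_ne_zero (by rintro rfl; omega)
          have h2 : c < 2 := by
            by_contra! h2
            have := Nat.mul_le_mul_left (r + 1) h2
            omega
          omega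
        subst hc1
        omega
      refine hm (monomial_mem_of_le (fun x => ?_) hjk_mem)
      rcases hcases x with rfl | rfl | rfl
      · simp [hij.symm, hik.symm]
      · simp [hjk.symm, hjb]
      · simp [hjk, hjb, hmj]
  · intro hjk_notMem
    by_contra hi
    have h := hJ.eq_of_monomialCharacter_eq hi hjk_notMem hχ ⟨w, hw1⟩
    have h1 := DFunLike.congr_fun h i
    simp [hij.symm, hik.symm] at h1
    omega

theorem IsMonomialIdeal.exponent_add_eq {r : ℕ} {J : Ideal (MvPolynomial (Fin 3) ℂ)}
    (hJ : IsMonomialIdeal J) (hpow : ∀ i, (X i : MvPolynomial (Fin 3) ℂ) ^ (r + 1) ∈ J)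
    (hreg : ∀ ρ : ArGroup r 3 →* ℂˣ,
      ∃ w ∈ iso r 3 J ρ, w ≠ 0 ∧ ∀ w' ∈ iso r 3 J ρ, ∃ a : ℂ, w' = a • w)
    {i j k : Fin 3} (hij : i ≠ j) (hik : i ≠ k) (hjk : j ≠ k)
    (hprod : (X i : MvPolynomial (Fin 3) ℂ) * (X j * X k) ∈ J) {s t : ℕ}
    (hs1 : 1 ≤ s) (hsr : s ≤ r + 1) (ht1 : 1 ≤ t)
    (hs : (X i : MvPolynomial (Fin 3) ℂ) ^ s ∈ J ∧
      ∀ m < s, (X i : MvPolynomial (Fin 3) ℂ) ^ m ∉ J)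
    (ht : ((X j : MvPolynomial (Fin 3) ℂ) * X k) ^ t ∈ J ∧
      ∀ m < t, ((X j : MvPolynomial (Fin 3) ℂ) * X k) ^ m ∉ J) :
    s + t = r + 2 := by
  have key {a b : ℕ} := hJ.X_pow_mem_iff hpow hreg hij hik hjk hprod (a := a) (b := b)
  apply le_antisymm
  · by_contra! hlt
    refine ht.2 (r + 2 - s) (by omega) ?_
    obtain rfl | hs2 := hs1.eq_or_lt
    · rw [show r + 2 - 1 = r + 1 by omega, mul_pow]
      exact J.mul_mem_right _ (hpow j)
    · by_contra hmem
      exact hs.2 (s - 1) (by omega) ((key (by omega) (by omega) (by omega)).2 hmem)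
  · by_contra! hlt
    have hnot := (key hs1 (b := r + 1 - s) (by omega) (by omega)).1 hs.1
    have heq : r + 1 - s = t + (r + 1 - s - t) := by omega
    rw [heq, pow_add] at hnot
    exact hnot (J.mul_mem_right _ ht.1)

/-- Let `J` be a monomial ideal of `ℂ[Z_1,Z_2,Z_3]` containing
`I(o) = ⟨Z_1^(r+1), Z_2^(r+1), Z_3^(r+1), Z_1Z_2Z_3⟩` whose quotient is the regular
representation of `A_r(3)`. With `l_i` (resp. `l_{i,j}`) the least exponents with
`Z_i^(l_i) ∈ J` (resp. `(Z_iZ_j)^(l_{i,j}) ∈ J`), one has `1 ≤ l_i ≤ r+1` and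
`l_1 + l_{2,3} = l_2 + l_{1,3} = l_3 + l_{1,2} = r+2`. -/
theorem Ar3_monomial_ideal_exponent_relations (r : ℕ) (hr : 1 ≤ r)
    (J : Ideal (MvPolynomial (Fin 3) ℂ))
    (hmono : ∃ T : Set (Fin 3 →₀ ℕ),
      J = Ideal.span ((fun m => (monomial m (1 : ℂ) : MvPolynomial (Fin 3) ℂ)) '' T))
    (hIo : Ideal.span {(X 0 : MvPolynomial (Fin 3) ℂ) ^ (r + 1), X 1 ^ (r + 1),
      X 2 ^ (r + 1), X 0 * X 1 * X 2} ≤ J)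
    (hdim : Module.finrank ℂ (MvPolynomial (Fin 3) ℂ ⧸ J) = (r + 1) ^ 2)
    (hreg : ∀ ρ : ArGroup r 3 →* ℂˣ,
      ∃ w ∈ iso r 3 J ρ, w ≠ 0 ∧ ∀ w' ∈ iso r 3 J ρ, ∃ a : ℂ, w' = a • w)
    (l : Fin 3 → ℕ)
    (hl : ∀ i, (X i : MvPolynomial (Fin 3) ℂ) ^ l i ∈ J ∧
      ∀ m < l i, (X i : MvPolynomial (Fin 3) ℂ) ^ m ∉ J)
    (l12 l13 l23 : ℕ)
    (h12 : ((X 0 : MvPolynomial (Fin 3) ℂ) * X 1) ^ l12 ∈ J ∧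
      ∀ m < l12, ((X 0 : MvPolynomial (Fin 3) ℂ) * X 1) ^ m ∉ J)
    (h13 : ((X 0 : MvPolynomial (Fin 3) ℂ) * X 2) ^ l13 ∈ J ∧
      ∀ m < l13, ((X 0 : MvPolynomial (Fin 3) ℂ) * X 2) ^ m ∉ J)
    (h23 : ((X 1 : MvPolynomial (Fin 3) ℂ) * X 2) ^ l23 ∈ J ∧
      ∀ m < l23, ((X 1 : MvPolynomial (Fin 3) ℂ) * X 2) ^ m ∉ J) :
    (∀ i, 1 ≤ l i ∧ l i ≤ r + 1) ∧
    l 0 + l23 = r + 2 ∧ l 1 + l13 = r + 2 ∧ l 2 + l12 = r + 2 := by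
  have hJ : IsMonomialIdeal J := hmono
  have hpow (i : Fin 3) : (X i : MvPolynomial (Fin 3) ℂ) ^ (r + 1) ∈ J := by
    fin_cases i <;> exact hIo (Ideal.subset_span (by simp))
  have hprod : (X 0 : MvPolynomial (Fin 3) ℂ) * X 1 * X 2 ∈ J :=
    hIo (Ideal.subset_span (by simp))
  have hone : (1 : MvPolynomial (Fin 3) ℂ) ∉ J := by
    intro h
    obtain ⟨w, -, hw0, -⟩ := hreg 1
    obtain ⟨p, rfl⟩ := Ideal.Quotient.mk_surjective w
    rw [(Ideal.eq_top_iff_one J).2 h] at hw0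
    exact hw0 (Ideal.Quotient.eq_zero_iff_mem.2 trivial)
  have pos {p : MvPolynomial (Fin 3) ℂ} {t : ℕ} (ht : p ^ t ∈ J) : 1 ≤ t := by
    by_contra! h0
    rw [Nat.lt_one_iff.1 h0, pow_zero] at ht
    exact hone ht
  have hle (i : Fin 3) : l i ≤ r + 1 := by
    by_contra! h
    exact (hl i).2 _ h (hpow i)
  refine ⟨fun i => ⟨pos (hl i).1, hle i⟩, ?_, ?_, ?_⟩
  · exact hJ.exponent_add_eq hpow hreg (by decide) (by decide) (by decide)
      (by rwa [mul_assoc] at hprod) (pos (hl 0).1) (hle 0) (pos h23.1) (hl 0) h23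
  · exact hJ.exponent_add_eq hpow hreg (by decide) (by decide) (by decide)
      (by rwa [mul_comm (X 0), mul_assoc] at hprod) (pos (hl 1).1) (hle 1) (pos h13.1) (hl 1) h13
  · exact hJ.exponent_add_eq hpow hreg (by decide) (by decide) (by decide)
      (by rwa [mul_comm] at hprod) (pos (hl 2).1) (hle 2) (pos h12.1) (hl 2) h12
end
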